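/- arXiv:2303.16547 — 2 statements merged into one kernel-verified Lean document; each statement's English description precedes it below -/
import Mathlib

section
/- Let f be a Boolean function in n variables and let k ≥ 1 be an integer. Suppose that for every y ∈ 𝔽₂ⁿ the integer 2^k divides W_f(y), i.e., W_f(y) = 2^k·m(y) for some integer m(y). Then deg(f) ≤ n − k + 1. -/
/-- Inner product on 𝔽₂ⁿ. -/
def ip {n : ℕ} (x y : Fin n → ZMod 2) : ZMod 2 := ∑ i, x i * y i

/-- Walsh–Hadamard transform of a Boolean function. -/
def walsh {n : ℕ} (f : (Fin n → ZMod 2) → ZMod 2) (y : Fin n → ZMod 2) : ℤ :=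
  ∑ x, (-1 : ℤ) ^ (f x + ip x y).val

/-- Hamming weight of a vector in 𝔽₂ⁿ. -/
def wt {n : ℕ} (y : Fin n → ZMod 2) : ℕ := ∑ i, (y i).val

/-- Möbius transform of a Boolean function. -/
def mobius {n : ℕ} (f : (Fin n → ZMod 2) → ZMod 2) (y : Fin n → ZMod 2) : ZMod 2 :=
  ∑ x ∈ Finset.univ.filter (fun x : Fin n → ZMod 2 => ∀ i, x i * y i = x i), f x

/-- Algebraic degree of a Boolean function. -/
def degree {n : ℕ} (f : (Fin n → ZMod 2) → ZMod 2) : ℕ :=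
  (Finset.univ.filter (fun y => mobius f y = 1)).sup wt

open Finset

theorem neg_one_pow_val_add (a b : ZMod 2) :
    (-1 : ℤ) ^ (a + b).val = (-1) ^ a.val * (-1) ^ b.val := by
  revert a b; decide

theorem neg_one_pow_val_sum {ι : Type*} (s : Finset ι) (g : ι → ZMod 2) :
    (-1 : ℤ) ^ (∑ i ∈ s, g i).val = ∏ i ∈ s, (-1) ^ (g i).val := by
  classical
  induction s using Finset.induction_on with
  | empty => simp
  | insert a s ha ih => rw [sum_insert ha, prod_insert ha, neg_one_pow_val_add, ih]

theorem neg_one_pow_val (a : ZMod 2) : (-1 : ℤ) ^ a.val = 1 - 2 * a.val := by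
  revert a; decide

/-- The vectors whose support is contained in that of `y`. -/
def below {n : ℕ} (y : Fin n → ZMod 2) : Finset (Fin n → ZMod 2) :=
  univ.filter fun x => ∀ i, x i * y i = x i

theorem wt_eq_card {n : ℕ} (y : Fin n → ZMod 2) : wt y = #{i | y i ≠ 0} := by
  rw [wt, card_filter]
  refine sum_congr rfl fun i _ => ?_
  generalize y i = a
  revert a; decide

theorem card_below {n : ℕ} (y : Fin n → ZMod 2) : #(below y) = 2 ^ wt y := by
  have h : below y = Fintype.piFinset fun i => univ.filter fun a : ZMod 2 => a * y i = a := by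
    ext x; simp [below]
  rw [h, Fintype.card_piFinset, wt, ← prod_pow_eq_pow_sum]
  refine prod_congr rfl fun i _ => ?_
  generalize y i = a
  revert a; decide

/-- The sum of the characters `z ↦ (-1)^⟨x,z⟩` over the vectors `z` supported off `y`. -/
theorem sum_neg_one_pow_ip {n : ℕ} (x y : Fin n → ZMod 2) :
    ∑ z ∈ Fintype.piFinset (fun i => univ.filter fun a : ZMod 2 => a * y i = 0),
      (-1 : ℤ) ^ (ip x z).val = if x ∈ below y then 2 ^ (n - wt y) else 0 := by
  have hexp : n - wt y = ∑ i, (1 - (y i).val) := by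
    have hn : ∑ i, ((1 - (y i).val) + (y i).val) = n := by
      have h1 (i : Fin n) : 1 - (y i).val + (y i).val = 1 := by
        generalize y i = a
        revert a; decide
      simp [h1]
    rw [sum_add_distrib] at hn
    rw [wt]; omega
  simp only [ip, neg_one_pow_val_sum]
  rw [← prod_univ_sum (fun i => univ.filter fun a : ZMod 2 => a * y i = 0)
    (fun i a => (-1 : ℤ) ^ (x i * a).val)]
  have hfac (i : Fin n) : ∑ a : ZMod 2 with a * y i = 0, (-1 : ℤ) ^ (x i * a).val
      = if x i * y i = x i then 2 ^ (1 - (y i).val) else 0 := by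
    generalize y i = a
    generalize x i = b
    revert a b; decide
  simp only [hfac, below, mem_filter, mem_univ, true_and]
  split_ifs with hx
  · rw [hexp, ← prod_pow_eq_pow_sum]
    exact prod_congr rfl fun i _ => if_pos (hx i)
  · obtain ⟨i, hi⟩ := not_forall.mp hx
    exact prod_eq_zero (mem_univ i) (if_neg hi)

/-- Poisson summation for the Walsh–Hadamard transform on a coordinate subspace. -/
theorem sum_walsh {n : ℕ} (f : (Fin n → ZMod 2) → ZMod 2) (y : Fin n → ZMod 2) :
    ∑ z ∈ Fintype.piFinset (fun i => univ.filter fun a : ZMod 2 => a * y i = 0), walsh f z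
      = 2 ^ (n - wt y) * ∑ x ∈ below y, (-1 : ℤ) ^ (f x).val := by
  simp only [walsh, neg_one_pow_val_add]
  rw [sum_comm]
  simp only [← mul_sum, sum_neg_one_pow_ip]
  simp [mul_sum, mul_comm, sum_ite_mem]

theorem sum_below_neg_one_pow {n : ℕ} (f : (Fin n → ZMod 2) → ZMod 2) (y : Fin n → ZMod 2) :
    ∑ x ∈ below y, (-1 : ℤ) ^ (f x).val = 2 ^ wt y - 2 * (∑ x ∈ below y, (f x).val : ℕ) := by
  simp [neg_one_pow_val, sum_sub_distrib, ← mul_sum, card_below]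

theorem odd_sum_below_of_mobius_eq_one {n : ℕ} {f : (Fin n → ZMod 2) → ZMod 2}
    {y : Fin n → ZMod 2} (hy : mobius f y = 1) : Odd (∑ x ∈ below y, (f x).val) := by
  rw [← ZMod.natCast_eq_one_iff_odd]
  simpa [below, mobius] using hy

theorem pow_two_dvd_of_dvd_walsh {n k : ℕ} {f : (Fin n → ZMod 2) → ZMod 2}
    (h : ∀ y, (2 : ℤ) ^ k ∣ walsh f y) (y : Fin n → ZMod 2) :
    (2 : ℤ) ^ k ∣ 2 ^ (n - wt y) * ∑ x ∈ below y, (-1 : ℤ) ^ (f x).val :=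
  sum_walsh f y ▸ dvd_sum fun z _ => h z

theorem le_of_pow_two_dvd_mul_odd {k m : ℕ} {a : ℤ} (ha : Odd a)
    (h : (2 : ℤ) ^ k ∣ 2 ^ m * a) : k ≤ m := by
  have hc : IsCoprime ((2 : ℤ) ^ k) a := (Int.isCoprime_two_left.mpr ha).pow_left
  have h2 : (2 : ℤ) ^ k ∣ 2 ^ m := hc.dvd_of_dvd_mul_right h
  exact (Nat.pow_dvd_pow_iff_le_right (by norm_num : 1 < 2)).mp (by exact_mod_cast h2)

theorem le_of_pow_two_dvd_walsh {n k : ℕ} {f : (Fin n → ZMod 2) → ZMod 2}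
    (h : ∀ y, (2 : ℤ) ^ k ∣ walsh f y) : k ≤ n := by
  have h0 := pow_two_dvd_of_dvd_walsh h 0
  have hw : wt (0 : Fin n → ZMod 2) = 0 := by simp [wt]
  rw [sum_below_neg_one_pow, hw] at h0
  exact le_of_pow_two_dvd_mul_odd (by rw [pow_zero]; exact odd_one.sub_even (even_two_mul _)) h0

/-- If `2^k` divides every Walsh–Hadamard coefficient of `f` (with `k ≥ 1`),
then `deg f ≤ n - k + 1`. -/
theorem degree_le_of_pow_two_dvd_walsh (n k : ℕ) (hk : 1 ≤ k)
    (f : (Fin n → ZMod 2) → ZMod 2)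
    (h : ∀ y : Fin n → ZMod 2, (2 : ℤ) ^ k ∣ walsh f y) :
    (degree f : ℤ) ≤ (n : ℤ) - k + 1 := by
  have hkn := le_of_pow_two_dvd_walsh h
  suffices hd : degree f ≤ n - k + 1 by omega
  refine Finset.sup_le fun y hy => ?_
  have hodd := odd_sum_below_of_mobius_eq_one (mem_filter.mp hy).2
  have hdvd := pow_two_dvd_of_dvd_walsh h y
  have hwn : wt y ≤ n := by
    rw [wt_eq_card]
    exact (card_le_univ _).trans_eq (Fintype.card_fin n)
  rcases Nat.lt_or_ge (wt y) 2 with hw | hw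
  · omega
  obtain ⟨w, hw⟩ := Nat.exists_eq_add_of_le hw
  have hpow : (2 : ℤ) ^ wt y = 2 * (2 * 2 ^ w) := by rw [hw]; ring
  rw [sum_below_neg_one_pow, hpow, ← mul_sub, ← mul_assoc, ← pow_succ] at hdvd
  have := le_of_pow_two_dvd_mul_odd
    ((even_two_mul ((2 : ℤ) ^ w)).sub_odd (by exact_mod_cast hodd)) hdvd
  omega
end

section
/- Let n ≥ 1 and 0 ≤ s ≤ n with n + s even. A Boolean function f : 𝔽₂ⁿ → 𝔽₂ is s-plateaued if and only if for every x ∈ 𝔽₂ⁿ the triple convolution satisfies ((−1)^f ∗ (−1)^f ∗ (−1)^f)(x) = 2^{n+s}·(−1)^{f(x)}, where (G ∗ H)(z) = ∑_{x ∈ 𝔽₂ⁿ} G(x)·H(z ⊕ x) for G, H : 𝔽₂ⁿ → ℤ. -/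
/-- `f` is `s`-plateaued: all Walsh coefficients lie in `{0, ±2^((n+s)/2)}`. -/
def IsPlateaued {n : ℕ} (s : ℕ) (f : (Fin n → ZMod 2) → ZMod 2) : Prop :=
  ∀ y, walsh f y = 0 ∨ walsh f y = 2 ^ ((n + s) / 2) ∨ walsh f y = -2 ^ ((n + s) / 2)

/-- Convolution of integer-valued functions on 𝔽₂ⁿ. -/
def conv {n : ℕ} (G H : (Fin n → ZMod 2) → ℤ) (z : Fin n → ZMod 2) : ℤ :=
  ∑ x, G x * H (z + x)

open Finset

/-- The character `x ↦ (-1)^⟨x, y⟩` of 𝔽₂ⁿ. -/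
def signChar {n : ℕ} (x y : Fin n → ZMod 2) : ℤ := (-1) ^ (ip x y).val

/-- The Fourier transform of an integer-valued function on 𝔽₂ⁿ. -/
def fourierSum {n : ℕ} (G : (Fin n → ZMod 2) → ℤ) (y : Fin n → ZMod 2) : ℤ :=
  ∑ x, G x * signChar x y

theorem ip_add_left {n : ℕ} (x x' y : Fin n → ZMod 2) : ip (x + x') y = ip x y + ip x' y := by
  simp [ip, add_mul, sum_add_distrib]

theorem ip_add_right {n : ℕ} (x y y' : Fin n → ZMod 2) : ip x (y + y') = ip x y + ip x y' := by
  simp [ip, mul_add, sum_add_distrib]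

theorem signChar_add_left {n : ℕ} (x x' y : Fin n → ZMod 2) :
    signChar (x + x') y = signChar x y * signChar x' y := by
  simp only [signChar, ip_add_left, neg_one_pow_val_add]

theorem signChar_add_right {n : ℕ} (x y y' : Fin n → ZMod 2) :
    signChar x (y + y') = signChar x y * signChar x y' := by
  simp only [signChar, ip_add_right, neg_one_pow_val_add]

theorem add_self_eq_zero_zmod_two {n : ℕ} (x : Fin n → ZMod 2) : x + x = 0 :=
  funext fun _ => CharTwo.add_self_eq_zero _

theorem add_add_cancel_zmod_two {n : ℕ} (x z : Fin n → ZMod 2) : x + (x + z) = z := by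
  rw [← add_assoc, add_self_eq_zero_zmod_two, zero_add]

theorem sum_signChar_eq_zero {n : ℕ} {x : Fin n → ZMod 2} (hx : x ≠ 0) :
    ∑ y, signChar x y = 0 := by
  obtain ⟨i, hi⟩ := Function.ne_iff.mp hx
  have hi1 : x i = 1 := by
    have key : ∀ a : ZMod 2, a ≠ 0 → a = 1 := by decide
    exact key _ hi
  have h_single : signChar x (Pi.single i 1) = -1 := by
    simp [signChar, ip, Pi.single_apply, hi1, ZMod.val_one]
  have h_shift : ∑ y, signChar x (y + Pi.single i 1) = ∑ y, signChar x y :=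
    Equiv.sum_comp (Equiv.addRight (Pi.single i 1)) (signChar x)
  simp only [signChar_add_right, h_single, mul_neg, mul_one, sum_neg_distrib] at h_shift
  linarith

theorem sum_signChar {n : ℕ} (x : Fin n → ZMod 2) :
    ∑ y, signChar x y = if x = 0 then 2 ^ n else 0 := by
  split_ifs with hx
  · simp [hx, signChar, ip]
  · exact sum_signChar_eq_zero hx

/-- Fourier inversion. -/
theorem sum_fourierSum_mul_signChar {n : ℕ} (G : (Fin n → ZMod 2) → ℤ) (z : Fin n → ZMod 2) :
    ∑ y, fourierSum G y * signChar z y = 2 ^ n * G z := by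
  have h_eq (x : Fin n → ZMod 2) : x + z = 0 ↔ x = z := by
    rw [← add_self_eq_zero_zmod_two z, add_left_inj]
  simp only [fourierSum, sum_mul, mul_assoc, ← signChar_add_left]
  rw [sum_comm]
  simp only [← mul_sum, sum_signChar, h_eq]
  simp [mul_comm]

theorem fourierSum_injective {n : ℕ} :
    Function.Injective (fourierSum : ((Fin n → ZMod 2) → ℤ) → _) := by
  intro G H h
  funext z
  have hz := sum_fourierSum_mul_signChar G z
  rw [h, sum_fourierSum_mul_signChar] at hz
  exact (mul_left_cancel₀ (by positivity) hz).symm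

theorem fourierSum_conv {n : ℕ} (G H : (Fin n → ZMod 2) → ℤ) (y : Fin n → ZMod 2) :
    fourierSum (conv G H) y = fourierSum G y * fourierSum H y := by
  simp only [fourierSum, conv, sum_mul]
  rw [sum_comm]
  refine sum_congr rfl fun x _ => ?_
  rw [mul_sum, ← Equiv.sum_comp (Equiv.addLeft x)]
  refine sum_congr rfl fun z _ => ?_
  rw [Equiv.coe_addLeft, add_comm (x + z) x, add_add_cancel_zmod_two, signChar_add_left]
  ring

theorem fourierSum_const_mul {n : ℕ} (c : ℤ) (G : (Fin n → ZMod 2) → ℤ) (y : Fin n → ZMod 2) :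
    fourierSum (fun x => c * G x) y = c * fourierSum G y := by
  simp only [fourierSum, mul_sum, mul_assoc]

theorem fourierSum_neg_one_pow {n : ℕ} (f : (Fin n → ZMod 2) → ZMod 2) (y : Fin n → ZMod 2) :
    fourierSum (fun v => (-1 : ℤ) ^ (f v).val) y = walsh f y := by
  simp only [fourierSum, walsh, signChar, neg_one_pow_val_add]

theorem mul_self_mul_eq_sq_mul_iff {R : Type*} [CommRing R] [IsDomain R] (w c : R) :
    w * w * w = c ^ 2 * w ↔ w = 0 ∨ w = c ∨ w = -c := by
  rw [mul_eq_mul_right_iff, ← sq, sq_eq_sq_iff_eq_or_eq_neg, or_comm]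

/-- A Boolean function `f` is `s`-plateaued iff the triple convolution of `(-1)^f`
with itself equals `2^(n+s)·(-1)^f`. -/
theorem plateaued_iff_triple_conv (n s : ℕ) (hn : 1 ≤ n) (hs : s ≤ n)
    (hpar : (n + s) % 2 = 0) (f : (Fin n → ZMod 2) → ZMod 2) :
    IsPlateaued s f ↔
      ∀ x : Fin n → ZMod 2,
        conv (conv (fun v => (-1 : ℤ) ^ (f v).val) (fun v => (-1 : ℤ) ^ (f v).val))
            (fun v => (-1 : ℤ) ^ (f v).val) x
          = 2 ^ (n + s) * (-1 : ℤ) ^ (f x).val := by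
  have h_pow : (2 : ℤ) ^ (n + s) = (2 ^ ((n + s) / 2)) ^ 2 := by
    rw [← pow_mul, Nat.div_mul_cancel (Nat.dvd_of_mod_eq_zero hpar)]
  rw [← funext_iff (g := fun x => 2 ^ (n + s) * (-1 : ℤ) ^ (f x).val),
    ← fourierSum_injective.eq_iff, funext_iff]
  refine forall_congr' fun y => ?_
  rw [fourierSum_conv, fourierSum_conv, fourierSum_const_mul, fourierSum_neg_one_pow, h_pow,
    mul_self_mul_eq_sq_mul_iff]
end
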